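/- arXiv:1408.1231 — 2 statements merged into one kernel-verified Lean document; each statement's English description precedes it below -/
import Mathlib

section
/- Let m, n ≥ 1. There exists a morphism (of Boolean inverse ∧-monoids) from the symmetric inverse monoid I_m to the symmetric inverse monoid I_n if and only if m divides n. -/
namespace Coordinatization

/-- The data of a monoid with zero equipped with an inverse operation. -/
structure InvMonData (S : Type) where
  mul : S → S → S
  one : S
  zero : S
  inv : S → S

variable {S T : Type}

/-- `M` is an inverse monoid with zero: a monoid with zero in which every element `a`
has a unique generalized inverse `a⁻¹`. -/
structure IsInverseMonoid (M : InvMonData S) : Prop where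
  mul_assoc : ∀ a b c, M.mul (M.mul a b) c = M.mul a (M.mul b c)
  one_mul : ∀ a, M.mul M.one a = a
  mul_one : ∀ a, M.mul a M.one = a
  zero_mul : ∀ a, M.mul M.zero a = M.zero
  mul_zero : ∀ a, M.mul a M.zero = M.zero
  inv_law₁ : ∀ a, M.mul (M.mul a (M.inv a)) a = a
  inv_law₂ : ∀ a, M.mul (M.mul (M.inv a) a) (M.inv a) = M.inv a
  inv_unique : ∀ a b, M.mul (M.mul a b) a = a → M.mul (M.mul b a) b = b → b = M.inv a

/-- `e` is an idempotent. -/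
def IsIdem (M : InvMonData S) (e : S) : Prop := M.mul e e = e

/-- The natural partial order: `a ≤ b` iff `a = b·e` for some idempotent `e`. -/
def nle (M : InvMonData S) (a b : S) : Prop := ∃ e, IsIdem M e ∧ a = M.mul b e

/-- `a` and `b` are compatible: `a⁻¹b` and `ab⁻¹` are both idempotents. -/
def Compatible (M : InvMonData S) (a b : S) : Prop :=
  IsIdem M (M.mul (M.inv a) b) ∧ IsIdem M (M.mul a (M.inv b))

/-- `a` and `b` are orthogonal: `a⁻¹b = 0 = ab⁻¹`. -/
def Orthogonal (M : InvMonData S) (a b : S) : Prop :=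
  M.mul (M.inv a) b = M.zero ∧ M.mul a (M.inv b) = M.zero

/-- `j` is the join of `a` and `b` with respect to the natural partial order. -/
def IsJoin (M : InvMonData S) (a b j : S) : Prop :=
  nle M a j ∧ nle M b j ∧ ∀ c, nle M a c → nle M b c → nle M j c

/-- `m` is the meet of `a` and `b` with respect to the natural partial order. -/
def IsMeet (M : InvMonData S) (a b m : S) : Prop :=
  nle M m a ∧ nle M m b ∧ ∀ c, nle M c a → nle M c b → nle M c m

/-- Green's relation `D`: `e D f` iff there is `a` with `a⁻¹a = e` and `aa⁻¹ = f`. -/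
def DRel (M : InvMonData S) (e f : S) : Prop :=
  ∃ a, M.mul (M.inv a) a = e ∧ M.mul a (M.inv a) = f

/-- `f` is a Boolean complement of the idempotent `e` in the Boolean algebra of
idempotents: `e·f = 0` and `e ∨ f = 1`. -/
def IsComplPair (M : InvMonData S) (e f : S) : Prop :=
  IsIdem M e ∧ IsIdem M f ∧ M.mul e f = M.zero ∧ IsJoin M e f M.one

/-- A Boolean inverse monoid: an inverse monoid with zero in which the idempotents form a
Boolean algebra under the natural partial order (meets of idempotents are given by products;
complements exist), all compatible binary joins exist, and multiplication distributes over
binary joins. -/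
structure IsBooleanInverseMonoid (M : InvMonData S) : Prop where
  invMon : IsInverseMonoid M
  joins_exist : ∀ a b, Compatible M a b → ∃ j, IsJoin M a b j
  mul_join_left : ∀ c a b j, IsJoin M a b j → IsJoin M (M.mul c a) (M.mul c b) (M.mul c j)
  mul_join_right : ∀ c a b j, IsJoin M a b j → IsJoin M (M.mul a c) (M.mul b c) (M.mul j c)
  compl_exists : ∀ e, IsIdem M e → ∃ f, IsComplPair M e f

/-- The relation `D` preserves complementation: `e D f` implies `ē D f̄`. -/
def DPreservesCompl (M : InvMonData S) : Prop :=
  ∀ e f e' f', DRel M e f → IsComplPair M e e' → IsComplPair M f f' → DRel M e' f'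

/-- `M` is completely semisimple: `e D f ≤ e` implies `e = f` for idempotents. -/
def CompletelySemisimple (M : InvMonData S) : Prop :=
  ∀ e f, IsIdem M e → IsIdem M f → DRel M e f → nle M f e → e = f

/-- A Foulis monoid: a completely semisimple Boolean inverse monoid in which `D`
preserves complementation. -/
def IsFoulis (M : InvMonData S) : Prop :=
  IsBooleanInverseMonoid M ∧ CompletelySemisimple M ∧ DPreservesCompl M

/-- The preorder underlying `S/J`: `Jle s t` iff `SsS ⊆ StS`, i.e. `s = a·t·b` for some `a, b`. -/
def Jle (M : InvMonData S) (s t : S) : Prop := ∃ a b, s = M.mul (M.mul a t) b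

/-- `S/J`, the poset of principal ideals, is a lattice. -/
def LatticeCondition (M : InvMonData S) : Prop :=
  ∀ s t : S,
    (∃ m, Jle M m s ∧ Jle M m t ∧ ∀ c, Jle M c s → Jle M c t → Jle M c m) ∧
    (∃ j, Jle M s j ∧ Jle M t j ∧ ∀ c, Jle M s c → Jle M t c → Jle M j c)

/-- `[e] ⊕ [f] = [g]` in `E(S)/D`: there are orthogonal idempotents `e' D e` and `f' D f`
whose join is `D`-related to `g`. -/
def OplusEq (M : InvMonData S) (e f g : S) : Prop :=
  ∃ e' f' j, IsIdem M e' ∧ IsIdem M f' ∧ DRel M e e' ∧ DRel M f f' ∧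
    M.mul e' f' = M.zero ∧ IsJoin M e' f' j ∧ DRel M j g

/-- `M` is fundamental: only idempotents commute with every idempotent. -/
def Fundamental (M : InvMonData S) : Prop :=
  ∀ s, (∀ e, IsIdem M e → M.mul s e = M.mul e s) → IsIdem M s

/-- `M` is factorizable: every element lies beneath a unit. -/
def Factorizable (M : InvMonData S) : Prop :=
  ∀ s, ∃ g, M.mul g (M.inv g) = M.one ∧ M.mul (M.inv g) g = M.one ∧ nle M s g

/-- All binary meets exist (`∧`-monoid). -/
def HasMeets (M : InvMonData S) : Prop := ∀ a b, ∃ m, IsMeet M a b m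

/-- A morphism of Boolean inverse `∧`-monoids: a monoid homomorphism mapping zero to zero,
preserving binary compatible joins and binary meets. -/
def IsMorphism (M : InvMonData S) (N : InvMonData T) (f : S → T) : Prop :=
  f M.one = N.one ∧ f M.zero = N.zero ∧
  (∀ a b, f (M.mul a b) = N.mul (f a) (f b)) ∧
  (∀ a b j, Compatible M a b → IsJoin M a b j → IsJoin N (f a) (f b) (f j)) ∧
  (∀ a b m, IsMeet M a b m → IsMeet N (f a) (f b) (f m))

end Coordinatization
namespace Coordinatization

/-- The symmetric inverse monoid `Iₙ` of all partial bijections of `Fin n`,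
with composition as multiplication, the identity as `1`, the empty map as `0`,
and the inverse partial bijection as inversion. -/
def symData (n : ℕ) : InvMonData (PEquiv (Fin n) (Fin n)) where
  mul f g := g.trans f
  one := PEquiv.refl (Fin n)
  zero := ⊥
  inv f := f.symm

/-- Direct products of inverse monoids, with componentwise operations. -/
def piData {ι : Type} {β : ι → Type} (Ms : ∀ i, InvMonData (β i)) :
    InvMonData (∀ i, β i) where
  mul f g i := (Ms i).mul (f i) (g i)
  one i := (Ms i).one
  zero i := (Ms i).zero
  inv f i := (Ms i).inv (f i)

/-- A semisimple inverse monoid: the finite direct product `I_{m 0} × ⋯ × I_{m (k-1)}`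
of finite symmetric inverse monoids. -/
def ssData (k : ℕ) (m : Fin k → ℕ) :
    InvMonData (∀ i : Fin k, PEquiv (Fin (m i)) (Fin (m i))) :=
  piData (fun i => symData (m i))

/-- The partial identity `1_A` on a subset `A` of `Fin n`. -/
def pid {n : ℕ} (A : Finset (Fin n)) : PEquiv (Fin n) (Fin n) where
  toFun x := if x ∈ A then some x else none
  invFun x := if x ∈ A then some x else none
  inv a b := by
    by_cases ha : a ∈ A <;> by_cases hb : b ∈ A <;>
      simp_all [Option.mem_def, eq_comm] <;> aesop

end Coordinatization
namespace Coordinatization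

theorem symData_mem_mul {n : ℕ} (f g : PEquiv (Fin n) (Fin n)) (x z : Fin n) :
    z ∈ (symData n).mul f g x ↔ ∃ y, y ∈ g x ∧ z ∈ f y :=
  PEquiv.mem_trans g f x z

theorem mem_pid {n : ℕ} (A : Finset (Fin n)) (x y : Fin n) :
    y ∈ pid A x ↔ x ∈ A ∧ y = x := by
  change y ∈ (if x ∈ A then some x else none) ↔ _
  split_ifs with h <;> simp [h, eq_comm]

theorem pid_symm {n : ℕ} (A : Finset (Fin n)) : (pid A).symm = pid A := rfl

theorem symData_mul_pid_pid {n : ℕ} (A B : Finset (Fin n)) :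
    (symData n).mul (pid A) (pid B) = pid (A ∩ B) := by
  apply PEquiv.ext_iff.2
  intro x
  apply Option.ext
  intro z
  change z ∈ (symData n).mul (pid A) (pid B) x ↔ z ∈ pid (A ∩ B) x
  simp only [symData_mem_mul, mem_pid, Finset.mem_inter]
  grind

theorem pid_singleton {n : ℕ} (i : Fin n) : pid {i} = PEquiv.single i i := by
  apply PEquiv.ext_iff.2
  intro x
  apply Option.ext
  intro z
  change z ∈ pid {i} x ↔ z ∈ PEquiv.single i i x
  rw [mem_pid, PEquiv.mem_single_iff, Finset.mem_singleton]
  grind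

theorem pid_univ {n : ℕ} : pid (Finset.univ : Finset (Fin n)) = PEquiv.refl (Fin n) := by
  apply PEquiv.ext_iff.2
  intro x
  simp [pid]

theorem pid_empty {n : ℕ} : pid (∅ : Finset (Fin n)) = ⊥ := by
  apply PEquiv.ext_iff.2
  intro x
  simp [pid]

theorem symData_isIdem_pid {n : ℕ} (A : Finset (Fin n)) : IsIdem (symData n) (pid A) := by
  rw [IsIdem, symData_mul_pid_pid, Finset.inter_self]

theorem symData_compatible_pid {n : ℕ} (A B : Finset (Fin n)) :
    Compatible (symData n) (pid A) (pid B) := by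
  constructor
  · change IsIdem _ ((symData n).mul (pid A).symm (pid B))
    rw [pid_symm, symData_mul_pid_pid]
    exact symData_isIdem_pid _
  · change IsIdem _ ((symData n).mul (pid A) (pid B).symm)
    rw [pid_symm, symData_mul_pid_pid]
    exact symData_isIdem_pid _

/-- Idempotents of the symmetric inverse monoid are partial identities. -/
theorem eq_of_mem_of_isIdem {n : ℕ} {e : PEquiv (Fin n) (Fin n)}
    (he : IsIdem (symData n) e) {x y : Fin n} (h : y ∈ e x) : y = x := by
  have h' := h
  rw [← he, symData_mem_mul] at h'
  obtain ⟨z, hz, hzy⟩ := h'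
  rw [Option.mem_unique hz h] at hzy
  exact e.inj hzy h

/-- The natural partial order of the symmetric inverse monoid is extension of partial maps. -/
theorem symData_nle_iff {n : ℕ} (a b : PEquiv (Fin n) (Fin n)) :
    nle (symData n) a b ↔ a ≤ b := by
  constructor
  · rintro ⟨e, he, rfl⟩ x y h
    obtain ⟨z, hz, hzy⟩ := (symData_mem_mul _ _ _ _).1 h
    rwa [eq_of_mem_of_isIdem he hz] at hzy
  · intro h
    refine ⟨pid {x | (a x).isSome}, symData_isIdem_pid _, ?_⟩
    apply PEquiv.ext_iff.2
    intro x
    apply Option.ext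
    intro z
    change z ∈ a x ↔ z ∈ (symData n).mul b (pid _) x
    simp only [symData_mem_mul, mem_pid, Finset.mem_filter, Finset.mem_univ, true_and]
    constructor
    · intro hz
      exact ⟨x, ⟨Option.isSome_of_mem hz, rfl⟩, h x z hz⟩
    · rintro ⟨y, ⟨hx, rfl⟩, hz⟩
      obtain ⟨w, hw⟩ := Option.isSome_iff_exists.1 hx
      rwa [Option.mem_unique hz (h y w hw)]

theorem symData_isJoin_iff {n : ℕ} (a b j : PEquiv (Fin n) (Fin n)) :
    IsJoin (symData n) a b j ↔ ∀ x y, y ∈ j x ↔ y ∈ a x ∨ y ∈ b x := by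
  simp only [IsJoin, symData_nle_iff]
  constructor
  · rintro ⟨ha, hb, hj⟩ x y
    refine ⟨fun h => ?_, fun h => h.elim (ha x y) (hb x y)⟩
    have key (c : PEquiv (Fin n) (Fin n)) (hc : c ≤ j) (hx : ∀ y, y ∈ c x → y ∈ a x ∨ y ∈ b x)
        (hs : (c x).isSome) : y ∈ a x ∨ y ∈ b x := by
      obtain ⟨w, hw⟩ := Option.isSome_iff_exists.1 hs
      rw [Option.mem_unique h (hc x w hw)]
      exact hx w hw
    have hle : j ≤ (symData n).mul j (pid {x | (a x).isSome ∨ (b x).isSome}) := by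
      apply hj
      · intro u v huv
        rw [symData_mem_mul]
        exact ⟨u, (mem_pid _ _ _).2 ⟨by simp [Option.isSome_of_mem huv], rfl⟩, ha u v huv⟩
      · intro u v huv
        rw [symData_mem_mul]
        exact ⟨u, (mem_pid _ _ _).2 ⟨by simp [Option.isSome_of_mem huv], rfl⟩, hb u v huv⟩
    obtain ⟨z, hz, -⟩ := (symData_mem_mul _ _ _ _).1 (hle x y h)
    rw [mem_pid, Finset.mem_filter] at hz
    rcases hz.1.2 with hs | hs
    · exact key a ha (fun _ => Or.inl) hs
    · exact key b hb (fun _ => Or.inr) hs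
  · intro h
    refine ⟨fun x y hy => (h x y).2 (Or.inl hy), fun x y hy => (h x y).2 (Or.inr hy), ?_⟩
    intro c hac hbc x y hy
    exact ((h x y).1 hy).elim (hac x y) (hbc x y)

theorem symData_isMeet_iff {n : ℕ} (a b m : PEquiv (Fin n) (Fin n)) :
    IsMeet (symData n) a b m ↔ ∀ x y, y ∈ m x ↔ y ∈ a x ∧ y ∈ b x := by
  simp only [IsMeet, symData_nle_iff]
  constructor
  · rintro ⟨ha, hb, hm⟩ x y
    refine ⟨fun h => ⟨ha x y h, hb x y h⟩, fun h => hm (a ⊓ b) inf_le_left inf_le_right x y ?_⟩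
    change y ∈ (if a x = b x then a x else none)
    rw [if_pos (h.1.trans h.2.symm)]
    exact h.1
  · intro h
    exact ⟨fun x y hy => ((h x y).1 hy).1, fun x y hy => ((h x y).1 hy).2,
      fun c hca hcb x y hy => (h x y).2 ⟨hca x y hy, hcb x y hy⟩⟩

/-- A partial bijection of `α` acting on the first coordinate of `β ≃ α × γ`. -/
def amplify {α β γ : Type*} (E : β ≃ α × γ) (f : PEquiv α α) : PEquiv β β where
  toFun x := (f (E x).1).map fun i => E.symm (i, (E x).2)
  invFun x := (f.symm (E x).1).map fun i => E.symm (i, (E x).2)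
  inv x y := by
    simp only [Option.map_eq_some_iff, E.symm_apply_eq, Prod.ext_iff]
    have := f.eq_some_iff (a := (E x).1) (b := (E y).1)
    grind

theorem mem_amplify {α β γ : Type*} (E : β ≃ α × γ) (f : PEquiv α α) (x y : β) :
    y ∈ amplify E f x ↔ (E y).1 ∈ f (E x).1 ∧ (E y).2 = (E x).2 := by
  change y ∈ (f (E x).1).map (fun i => E.symm (i, (E x).2)) ↔ _
  simp only [Option.mem_def, Option.map_eq_some_iff, E.symm_apply_eq, Prod.ext_iff]
  grind

theorem isMorphism_amplify {m n k : ℕ} (E : Fin n ≃ Fin m × Fin k) :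
    IsMorphism (symData m) (symData n) (amplify E) := by
  refine ⟨?_, ?_, fun a b => ?_, fun a b j _ hj => ?_, fun a b c hc => ?_⟩
  · apply PEquiv.ext_iff.2
    intro x
    simp [symData, amplify]
  · apply PEquiv.ext_iff.2
    intro x
    simp [symData, amplify]
  · apply PEquiv.ext_iff.2
    intro x
    apply Option.ext
    intro z
    change z ∈ amplify E _ x ↔ z ∈ (symData n).mul (amplify E a) (amplify E b) x
    simp only [symData_mem_mul, mem_amplify]
    constructor
    · rintro ⟨⟨i, hi, hz⟩, h⟩
      exact ⟨E.symm (i, (E x).2), by simpa using hi, by simpa [h] using hz⟩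
    · rintro ⟨y, ⟨hi, h⟩, hz, h'⟩
      exact ⟨⟨_, hi, hz⟩, h'.trans h⟩
  · rw [symData_isJoin_iff] at hj ⊢
    intro x y
    simp only [mem_amplify, hj]
    tauto
  · rw [symData_isMeet_iff] at hc ⊢
    intro x y
    simp only [mem_amplify, hc]
    tauto

section Morphism

variable {m n : ℕ} {θ : PEquiv (Fin m) (Fin m) → PEquiv (Fin n) (Fin n)}

theorem IsMorphism.isIdem {S T : Type} {M : InvMonData S} {N : InvMonData T} {f : S → T}
    (hf : IsMorphism M N f) {e : S} (he : IsIdem M e) : IsIdem N (f e) := by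
  rw [IsIdem, ← hf.2.2.1, he]

theorem IsMorphism.exists_mem_single (hθ : IsMorphism (symData m) (symData n) θ)
    (A : Finset (Fin m)) {x : Fin n} (hx : x ∈ θ (pid A) x) :
    ∃ i ∈ A, x ∈ θ (PEquiv.single i i) x := by
  induction A using Finset.induction_on with
  | empty =>
    rw [pid_empty, show θ ⊥ = ⊥ from hθ.2.1] at hx
    simp at hx
  | insert a A _ ih =>
    have hj : IsJoin (symData m) (pid {a}) (pid A) (pid (insert a A)) := by
      rw [symData_isJoin_iff]
      intro x y
      simp only [mem_pid, Finset.mem_insert, Finset.mem_singleton]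
      tauto
    have := hθ.2.2.2.1 _ _ _ (symData_compatible_pid _ _) hj
    rw [symData_isJoin_iff] at this
    rcases (this x x).1 hx with h | h
    · exact ⟨a, Finset.mem_insert_self _ _, pid_singleton a ▸ h⟩
    · obtain ⟨i, hi, h⟩ := ih h
      exact ⟨i, Finset.mem_insert_of_mem hi, h⟩

theorem IsMorphism.map_trans (hθ : IsMorphism (symData m) (symData n) θ)
    (f g : PEquiv (Fin m) (Fin m)) : θ (f.trans g) = (θ f).trans (θ g) :=
  hθ.2.2.1 g f

theorem IsMorphism.single_unique (hθ : IsMorphism (symData m) (symData n) θ)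
    {i j : Fin m} {x : Fin n} (hi : x ∈ θ (PEquiv.single i i) x)
    (hj : x ∈ θ (PEquiv.single j j) x) : i = j := by
  by_contra hij
  have h : x ∈ ((θ (PEquiv.single i i)).trans (θ (PEquiv.single j j))) x :=
    (PEquiv.mem_trans _ _ _ _).2 ⟨x, hi, hj⟩
  rw [← hθ.map_trans, PEquiv.single_trans_single_of_ne hij, show θ ⊥ = ⊥ from hθ.2.1] at h
  simp at h

theorem IsMorphism.exists_mem_single_of_mem (hθ : IsMorphism (symData m) (symData n) θ)
    (i j : Fin m) {x : Fin n} (hx : x ∈ θ (PEquiv.single i i) x) :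
    ∃ y, y ∈ θ (PEquiv.single i j) x ∧ y ∈ θ (PEquiv.single j j) y := by
  have h := hx
  rw [← PEquiv.single_trans_single i j i, hθ.map_trans, PEquiv.mem_trans] at h
  obtain ⟨y, hxy, hyx⟩ := h
  refine ⟨y, hxy, ?_⟩
  rw [← PEquiv.single_trans_single j i j, hθ.map_trans, PEquiv.mem_trans]
  exact ⟨x, hyx, hxy⟩

theorem IsMorphism.card_single_le (hθ : IsMorphism (symData m) (symData n) θ) (i j : Fin m) :
    Finset.card {x | x ∈ θ (PEquiv.single i i) x} ≤
      Finset.card {x | x ∈ θ (PEquiv.single j j) x} := by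
  refine Finset.card_le_card_of_forall_subsingleton (fun x y => y ∈ θ (PEquiv.single i j) x)
    (fun x hx => ?_) fun y _ x hx x' hx' => (θ _).inj hx.2 hx'.2
  obtain ⟨y, hxy, hy⟩ := hθ.exists_mem_single_of_mem i j (Finset.mem_filter.1 hx).2
  exact ⟨y, by simpa using hy, hxy⟩

theorem IsMorphism.dvd (hm : 1 ≤ m) (hθ : IsMorphism (symData m) (symData n) θ) : m ∣ n := by
  have hex (x : Fin n) : ∃ i, x ∈ θ (PEquiv.single i i) x := by
    obtain ⟨i, -, hi⟩ := hθ.exists_mem_single Finset.univ (x := x) (by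
      rw [pid_univ, show θ (PEquiv.refl _) = PEquiv.refl _ from hθ.1]
      simp)
    exact ⟨i, hi⟩
  choose p hp using hex
  have hfib (x : Fin n) (i : Fin m) : p x = i ↔ x ∈ θ (PEquiv.single i i) x :=
    ⟨fun h => h ▸ hp x, fun h => hθ.single_unique (hp x) h⟩
  have hcard := Finset.card_eq_sum_card_fiberwise (f := p) (s := Finset.univ)
    (t := Finset.univ) (fun _ _ => Finset.mem_coe.2 (Finset.mem_univ _))
  simp only [hfib] at hcard
  rw [Finset.sum_congr rfl fun i _ =>
    le_antisymm (hθ.card_single_le i ⟨0, hm⟩) (hθ.card_single_le ⟨0, hm⟩ i)] at hcard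
  simp only [Finset.card_univ, Fintype.card_fin, Finset.sum_const, smul_eq_mul] at hcard
  exact ⟨_, hcard⟩

end Morphism

/-- There is a morphism of Boolean inverse `∧`-monoids from the symmetric inverse monoid
`I_m` to the symmetric inverse monoid `I_n` if, and only if, `m` divides `n`. -/
theorem morphism_symmetric_iff_dvd (m n : ℕ) (hm : 1 ≤ m) (hn : 1 ≤ n) :
    (∃ θ : PEquiv (Fin m) (Fin m) → PEquiv (Fin n) (Fin n),
      IsMorphism (symData m) (symData n) θ) ↔ m ∣ n := by
  refine ⟨fun ⟨θ, hθ⟩ => hθ.dvd hm, ?_⟩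
  rintro ⟨k, rfl⟩
  exact ⟨_, isMorphism_amplify finProdFinEquiv.symm⟩

end Coordinatization
end

section
/- Let A be a finite alphabet with n ≥ 2 letters. Define the weight of a finite prefix code X to be the sum of the lengths of its words. Let U ⊆ A^ω and suppose U = XA^ω = YA^ω where X and Y are prefix codes of the same weight p, and every prefix code Z with U = ZA^ω has weight at least p. Then X = Y. Consequently, every set of the form XA^ω (X a finite prefix code) has a unique generating prefix code of minimum weight. -/
namespace Coordinatization

/-- The infinite word obtained by prepending the finite word `l` to the infinite word `w`. -/
def app {A : Type} (l : List A) (w : ℕ → A) : ℕ → A :=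
  fun k => if h : k < l.length then l.get ⟨k, h⟩ else w (k - l.length)

/-- The cylinder `xA^ω`: the set of infinite words having the finite word `x` as a prefix. -/
def cyl {A : Type} (x : List A) : Set (ℕ → A) := {w | ∃ u, w = app x u}

/-- `XA^ω` for a finite set `X` of finite words. -/
def cylU {A : Type} (X : Finset (List A)) : Set (ℕ → A) := ⋃ x ∈ X, cyl x

/-- A (finite) prefix code: no element is a proper prefix of another. -/
def IsPrefixCode {A : Type} (X : Finset (List A)) : Prop :=
  ∀ x ∈ X, ∀ y ∈ X, x <+: y → x = y

/-- A maximal prefix code: a prefix code not properly contained in any other prefix code. -/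
def IsMaximalPrefixCode {A : Type} (X : Finset (List A)) : Prop :=
  IsPrefixCode X ∧ ∀ Y : Finset (List A), IsPrefixCode Y → X ⊆ Y → X = Y

/-- The weight of a prefix code: the sum of the lengths of its words. -/
def weight {A : Type} (X : Finset (List A)) : ℕ := ∑ x ∈ X, x.length

end Coordinatization
namespace Coordinatization

section

variable {A : Type}

theorem mem_cyl_iff {x : List A} {w : ℕ → A} :
    w ∈ cyl x ↔ x = (List.range x.length).map w := by
  constructor
  · rintro ⟨u, rfl⟩
    refine List.ext_getElem (by simp) fun i h _ => ?_
    simp [app, h]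
  · intro hx
    refine ⟨fun k => w (k + x.length), funext fun k => ?_⟩
    by_cases h : k < x.length
    · have hk : x[k]? = some (w k) := by
        rw [hx]
        simp [h]
      simp [app, h, (List.getElem?_eq_some_iff.1 hk).2]
    · simp [app, h, Nat.sub_add_cancel (not_lt.1 h)]

theorem cyl_nonempty [Nonempty A] (x : List A) : (cyl x).Nonempty :=
  ⟨app x fun _ => Classical.arbitrary A, _, rfl⟩

theorem mem_cylU {X : Finset (List A)} {w : ℕ → A} : w ∈ cylU X ↔ ∃ x ∈ X, w ∈ cyl x := by
  simp [cylU]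

theorem cyl_subset_cylU {X : Finset (List A)} {x : List A} (hx : x ∈ X) : cyl x ⊆ cylU X :=
  fun _ hw => mem_cylU.2 ⟨x, hx, hw⟩

theorem cyl_subset_cyl_of_prefix {x y : List A} (h : y <+: x) : cyl x ⊆ cyl y := by
  intro w hw
  rw [mem_cyl_iff] at hw ⊢
  have hlen := h.length_le
  rw [List.prefix_iff_eq_take] at h
  rw [hw, ← List.map_take, List.take_range, min_eq_left hlen] at h
  exact h

theorem prefix_or_prefix_of_mem_cyl {x y : List A} {w : ℕ → A} (hx : w ∈ cyl x)
    (hy : w ∈ cyl y) : x <+: y ∨ y <+: x := by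
  have key : ∀ {m n : ℕ}, m ≤ n → (List.range m).map w <+: (List.range n).map w := by
    intro m n h
    rw [List.prefix_iff_eq_take, ← List.map_take, List.take_range]
    simp [h]
  rw [mem_cyl_iff] at hx hy
  rw [hx, hy]
  exact (le_total x.length y.length).imp key key

/-- In a prefix code of minimum weight, every word is minimal for the prefix order among the
words whose cylinder lies in the generated set. -/
theorem eq_of_prefix_of_cyl_subset {X : Finset (List A)} (hX : IsPrefixCode X)
    (hmin : ∀ Z : Finset (List A), IsPrefixCode Z → cylU X = cylU Z → weight X ≤ weight Z)
    {x y : List A} (hx : x ∈ X) (hyx : y <+: x) (hy : cyl y ⊆ cylU X) : y = x := by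
  classical
  by_contra hne
  have hlt : y.length < x.length :=
    lt_of_le_of_ne hyx.length_le fun h => hne (hyx.eq_of_length h)
  let Z := insert y (X.filter fun z => ¬ y <+: z)
  have hZ : IsPrefixCode Z := by
    intro a ha b hb hab
    rcases Finset.mem_insert.1 ha with rfl | ha <;> rcases Finset.mem_insert.1 hb with rfl | hb
    · rfl
    · exact absurd hab (Finset.mem_filter.1 hb).2
    · have hax := hX a (Finset.mem_filter.1 ha).1 x hx (hab.trans hyx)
      subst hax
      exact absurd hyx (Finset.mem_filter.1 ha).2
    · exact hX a (Finset.mem_filter.1 ha).1 b (Finset.mem_filter.1 hb).1 hab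
  have hgen : cylU X = cylU Z := by
    ext w
    constructor
    · intro hw
      obtain ⟨z, hz, hwz⟩ := mem_cylU.1 hw
      by_cases h : y <+: z
      · exact mem_cylU.2 ⟨y, Finset.mem_insert_self _ _, cyl_subset_cyl_of_prefix h hwz⟩
      · exact mem_cylU.2 ⟨z, Finset.mem_insert_of_mem (Finset.mem_filter.2 ⟨hz, h⟩), hwz⟩
    · intro hw
      obtain ⟨z, hz, hwz⟩ := mem_cylU.1 hw
      rcases Finset.mem_insert.1 hz with rfl | hz
      · exact hy hwz
      · exact cyl_subset_cylU (Finset.mem_filter.1 hz).1 hwz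
  have hle := hmin Z hZ hgen
  have hwZ : weight Z = y.length + ∑ z ∈ X.filter (fun z => ¬ y <+: z), z.length :=
    Finset.sum_insert (by simp)
  have hwX : weight X = ∑ z ∈ X.filter (fun z => y <+: z), z.length +
      ∑ z ∈ X.filter (fun z => ¬ y <+: z), z.length :=
    (Finset.sum_filter_add_sum_filter_not X (fun z => y <+: z) List.length).symm
  have hsum : x.length ≤ ∑ z ∈ X.filter (fun z => y <+: z), z.length :=
    Finset.single_le_sum (f := List.length) (fun _ _ => Nat.zero_le _)
      (Finset.mem_filter.2 ⟨hx, hyx⟩)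
  omega

theorem subset_of_minimum_weight [Nonempty A] {X Y : Finset (List A)}
    (hX : IsPrefixCode X) (hY : IsPrefixCode Y) (hXY : cylU X = cylU Y)
    (hXmin : ∀ Z : Finset (List A), IsPrefixCode Z → cylU X = cylU Z → weight X ≤ weight Z)
    (hYmin : ∀ Z : Finset (List A), IsPrefixCode Z → cylU Y = cylU Z → weight Y ≤ weight Z) :
    X ⊆ Y := by
  intro x hx
  obtain ⟨w, hw⟩ := cyl_nonempty x
  obtain ⟨y, hy, hwy⟩ := mem_cylU.1 (hXY ▸ cyl_subset_cylU hx hw)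
  rcases prefix_or_prefix_of_mem_cyl hw hwy with h | h
  · exact eq_of_prefix_of_cyl_subset hY hYmin hy h (hXY ▸ cyl_subset_cylU hx) ▸ hy
  · exact eq_of_prefix_of_cyl_subset hX hXmin hx h (hXY ▸ cyl_subset_cylU hy) ▸ hy

theorem eq_of_minimum_weight [Nonempty A] {X Y : Finset (List A)}
    (hX : IsPrefixCode X) (hY : IsPrefixCode Y) (hXY : cylU X = cylU Y)
    (hXmin : ∀ Z : Finset (List A), IsPrefixCode Z → cylU X = cylU Z → weight X ≤ weight Z)
    (hYmin : ∀ Z : Finset (List A), IsPrefixCode Z → cylU Y = cylU Z → weight Y ≤ weight Z) :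
    X = Y :=
  (subset_of_minimum_weight hX hY hXY hXmin hYmin).antisymm
    (subset_of_minimum_weight hY hX hXY.symm hYmin hXmin)

theorem exists_minimum_weight {X₀ : Finset (List A)} (hX₀ : IsPrefixCode X₀) :
    ∃ Z : Finset (List A), IsPrefixCode Z ∧ cylU Z = cylU X₀ ∧
      ∀ Z' : Finset (List A), IsPrefixCode Z' → cylU Z' = cylU X₀ → weight Z ≤ weight Z' := by
  let S : Set (Finset (List A)) := {Z | IsPrefixCode Z ∧ cylU Z = cylU X₀}
  have hS : S.Nonempty := ⟨X₀, hX₀, rfl⟩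
  have hmem := Function.argminOn_mem weight S hS
  exact ⟨Function.argminOn weight S hS, hmem.1, hmem.2,
    fun Z' hZ' hgen => Function.argminOn_le weight S ⟨hZ', hgen⟩⟩

end

/-- If `U = XA^ω = YA^ω` where the prefix codes `X` and `Y` have the same weight `p` and
every prefix code generating `U` has weight at least `p`, then `X = Y`.  Consequently,
every set of the form `XA^ω` has a unique generating prefix code of minimum weight. -/
theorem minimum_weight_generating_code {A : Type} [Fintype A] (hA : 2 ≤ Fintype.card A)
    (U : Set (ℕ → A)) (X Y : Finset (List A))
    (hX : IsPrefixCode X) (hY : IsPrefixCode Y)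
    (hUX : U = cylU X) (hUY : U = cylU Y)
    (hw : weight X = weight Y)
    (hmin : ∀ Z : Finset (List A), IsPrefixCode Z → U = cylU Z → weight X ≤ weight Z) :
    X = Y ∧
    ∀ X₀ : Finset (List A), IsPrefixCode X₀ →
      ∃! Z : Finset (List A), IsPrefixCode Z ∧ cylU Z = cylU X₀ ∧
        ∀ Z' : Finset (List A), IsPrefixCode Z' → cylU Z' = cylU X₀ →
          weight Z ≤ weight Z' := by
  have : Nonempty A := Fintype.card_pos_iff.1 (by omega)
  subst hUX
  refine ⟨eq_of_minimum_weight hX hY hUY hmin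
    fun Z hZ h => hw ▸ hmin Z hZ (hUY.trans h), fun X₀ hX₀ => ?_⟩
  obtain ⟨Z, hZ, hgen, hZmin⟩ := exists_minimum_weight hX₀
  refine ⟨Z, ⟨hZ, hgen, hZmin⟩, ?_⟩
  rintro W ⟨hW, hWgen, hWmin⟩
  exact eq_of_minimum_weight hW hZ (hWgen.trans hgen.symm)
    (fun V hV h => hWmin V hV (h.symm.trans hWgen))
    (fun V hV h => hZmin V hV (h.symm.trans hgen))

end Coordinatization
end
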